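/- The directed Cayley graph of the alternating group A_5 with generators τ_3 = [3,1,2,4,5] and τ_5 = [5,1,2,3,4] has no directed Hamiltonian cycle. -/

import Mathlib

/-- `tau n k` is the permutation of positions `{1,…,n}` (0-indexed as `Fin n`) with
`τ_k(1)=k`, `τ_k(i)=i-1` for `2 ≤ i ≤ k`, and `τ_k(i)=i` for `i > k`. -/
def tau (n k : ℕ) : Equiv.Perm (Fin n) :=
  if h : k - 1 < n then (Fin.cycleRange ⟨k - 1, h⟩)⁻¹ else 1

theorem sign_of_cube {α : Type*} [Fintype α] [DecidableEq α] (f : Equiv.Perm α)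
    (h : ∀ x, f (f (f x)) = x) : Equiv.Perm.sign f = 1 := by
  have h3 : f ^ 3 = 1 := by
    ext x
    simp [pow_succ, h]
  have h4 := congrArg Equiv.Perm.sign h3
  rw [map_pow, map_one] at h4
  rcases Int.units_eq_one_or (Equiv.Perm.sign f) with h5 | h5
  · exact h5
  · rw [h5] at h4
    exact absurd h4 (by decide)

/-- Rankin's parity argument. -/
theorem rankin_sign {G : Type*} [Group G] [Fintype G] [DecidableEq G] (a b : G)
    (ha : a ^ 3 = 1) (hc : (b * a⁻¹) ^ 3 = 1) (hne : b * a⁻¹ ≠ 1) (σ : Equiv.Perm G)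
    (h : ∀ g, σ g = g * a ∨ σ g = g * b) : Equiv.Perm.sign σ = 1 := by
  have e : σ = Equiv.mulRight a * ((Equiv.mulRight a)⁻¹ * σ) := (mul_inv_cancel_left _ _).symm
  set ρ := (Equiv.mulRight a)⁻¹ * σ with hρ
  have hr : ∀ g, ρ g = g ∨ ρ g = g * (b * a⁻¹) := by
    intro g
    have : ρ g = σ g * a⁻¹ := by
      rw [hρ, Equiv.Perm.mul_apply, Equiv.Perm.inv_eq_iff_eq]
      simp
    rw [this]
    rcases h g with h | h <;> rw [h]
    · left; group
    · right; group
  have step : ∀ g, ρ g = g * (b * a⁻¹) → ρ (g * (b * a⁻¹)) = g * (b * a⁻¹) * (b * a⁻¹) := by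
    intro g hg
    rcases hr (g * (b * a⁻¹)) with h1 | h1
    · have := ρ.injective (h1.trans hg.symm)
      exact absurd (mul_eq_left.mp this) hne
    · exact h1
  rw [e, map_mul, sign_of_cube ρ, sign_of_cube (Equiv.mulRight a), one_mul]
  · intro x
    have : a * (a * a) = 1 := by rw [← ha, pow_succ, pow_two, mul_assoc]
    simp [mul_assoc, this]
  · intro g
    rcases hr g with h1 | h1
    · simp [h1]
    · have h2 := step g h1
      have h3 := step _ h2
      rw [h1, h2, h3, mul_assoc, mul_assoc, ← pow_two, ← pow_succ', hc, mul_one]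

/-- The directed Cayley graph of `A_5` with generators `τ_3 = [3,1,2,4,5]` and
`τ_5 = [5,1,2,3,4]` has no directed Hamiltonian cycle.  A directed Hamiltonian cycle is
encoded by a permutation `σ` of the vertex set `A_5` (the successor map) whose steps follow
directed edges and which is a single cycle through all of `A_5`. -/
theorem a5_not_hamiltonian :
    ¬ ∃ σ : Equiv.Perm ↥(alternatingGroup (Fin 5)),
        (∀ g : ↥(alternatingGroup (Fin 5)),
          (↑(σ g) : Equiv.Perm (Fin 5)) = ↑g * tau 5 3 ∨
          (↑(σ g) : Equiv.Perm (Fin 5)) = ↑g * tau 5 5) ∧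
        ∀ g h : ↥(alternatingGroup (Fin 5)), ∃ m : ℕ, (σ ^ m) g = h := by
  rintro ⟨σ, hσ, htr⟩
  let a : alternatingGroup (Fin 5) := ⟨tau 5 3, by rw [Equiv.Perm.mem_alternatingGroup]; decide⟩
  let b : alternatingGroup (Fin 5) := ⟨tau 5 5, by rw [Equiv.Perm.mem_alternatingGroup]; decide⟩
  have h1 : Equiv.Perm.sign σ = 1 := by
    refine rankin_sign a b ?_ ?_ ?_ σ ?_
    · apply Subtype.ext; change tau 5 3 ^ 3 = 1; decide
    · apply Subtype.ext; change (tau 5 5 * (tau 5 3)⁻¹) ^ 3 = 1; decide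
    · intro h
      have h' := congrArg Subtype.val h
      change tau 5 5 * (tau 5 3)⁻¹ = 1 at h'
      exact absurd h' (by decide)
    · intro g
      rcases hσ g with h | h
      · left; exact Subtype.ext h
      · right; exact Subtype.ext h
  have hne : ∀ g, σ g ≠ g := by
    intro g hg
    rcases hσ g with h | h <;> rw [hg] at h
    · exact absurd (left_eq_mul.mp h) (by decide)
    · exact absurd (left_eq_mul.mp h) (by decide)
  have hcyc : σ.IsCycle := by
    refine ⟨1, hne 1, fun y _ => ?_⟩
    obtain ⟨m, hm⟩ := htr 1 y
    exact ⟨m, by simpa using hm⟩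
  have hs : σ.support = Finset.univ := by
    ext g; simpa using hne g
  have hcard : Fintype.card (alternatingGroup (Fin 5)) = 60 := by
    rw [card_alternatingGroup]; decide
  have h2 := hcyc.sign
  rw [h1, hs, Finset.card_univ, hcard] at h2
  exact absurd h2 (by decide)
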